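/- For all integers p ≥ 2 and k ≥ p, one has the strict inequality Σ_k^p > pπ. (Theorem 4.3(i) of the paper.) -/

import Mathlib

open Set MeasureTheory Metric Filter Asymptotics
open scoped ENNReal Topology NNReal

noncomputable section

abbrev E2 : Type := EuclideanSpace ℝ (Fin 2)

def IsLipschitzDomain (Ω : Set E2) : Prop :=
  IsOpen Ω ∧ IsConnected Ω ∧ Bornology.IsBounded Ω ∧
    ∀ p ∈ frontier Ω, ∃ (e : E2 ≃ₗᵢ[ℝ] E2) (K : ℝ≥0) (φ : ℝ → ℝ) (U : Set E2),
      LipschitzWith K φ ∧ IsOpen U ∧ p ∈ U ∧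
      ∀ x ∈ U, (x ∈ Ω ↔ φ (e x 0) < e x 1)

def dirEnergy (Ω : Set E2) (f : E2 → ℝ) : ℝ≥0∞ :=
  ∫⁻ x in Ω, (‖fderiv ℝ f x‖₊ : ℝ≥0∞) ^ 2

def bdryInt (Γ : Set E2) (ρ f : E2 → ℝ) : ℝ≥0∞ :=
  ∫⁻ x in Γ, ENNReal.ofReal (ρ x * (f x) ^ 2) ∂μH[1]

def rayleigh (Ω Γ : Set E2) (ρ f : E2 → ℝ) : ℝ≥0∞ :=
  dirEnergy Ω f / bdryInt Γ ρ f

def steklovMixed (Ω ΓS ΓD : Set E2) (ρ : E2 → ℝ) (k : ℕ) : ℝ≥0∞ :=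
  ⨅ (V : Submodule ℝ (E2 → ℝ))
    (_ : Module.finrank ℝ V = k + 1)
    (_ : ∀ f ∈ V, ContDiff ℝ (⊤ : ℕ∞) f)
    (_ : ∀ f ∈ V, ∀ᶠ x in nhdsSet ΓD, f x = 0)
    (_ : ∀ f ∈ V, Set.EqOn f 0 (closure Ω) → f = 0),
    ⨆ f ∈ V, ⨆ (_ : ¬ Set.EqOn f 0 (closure Ω)), rayleigh Ω ΓS ρ f

def steklovN (Ω ΓS : Set E2) (k : ℕ) : ℝ≥0∞ :=
  steklovMixed Ω ΓS ∅ (fun _ => 1) k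

def steklovD (Ω ΓS ΓD : Set E2) (k : ℕ) : ℝ≥0∞ :=
  steklovMixed Ω ΓS ΓD (fun _ => 1) k

def steklovW (Ω : Set E2) (ρ : E2 → ℝ) (k : ℕ) : ℝ≥0∞ :=
  steklovMixed Ω (frontier Ω) ∅ ρ k

def steklov (Ω : Set E2) (k : ℕ) : ℝ≥0∞ := steklovW Ω (fun _ => 1) k

def IsArc (A : Set E2) : Prop :=
  ∃ γ : ℝ → E2, ContinuousOn γ (Icc 0 1) ∧ InjOn γ (Icc 0 1) ∧ A = γ '' Icc 0 1

def IsLoop (A : Set E2) : Prop :=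
  ∃ γ : ℝ → E2, ContinuousOn γ (Icc 0 1) ∧ InjOn γ (Ico 0 1) ∧ γ 0 = γ 1 ∧ A = γ '' Icc 0 1

def IsBoundaryPart (Γ : Set E2) : Prop :=
  ∃ F : Finset (Set E2), (∀ A ∈ F, IsArc A ∨ IsLoop A) ∧ Γ = ⋃₀ ↑F

structure SteklovDecomp (Ω ΓS Γstar : Set E2) : Prop where
  partS : IsBoundaryPart ΓS
  partStar : IsBoundaryPart Γstar
  union_eq : ΓS ∪ Γstar = frontier Ω
  inter_finite : (ΓS ∩ Γstar).Finite
  nonemptyS : ΓS.Nonempty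

/-- Rotation of the plane by angle θ about the origin. -/
def rotBy (θ : ℝ) : E2 → E2 := fun x =>
  (WithLp.equiv 2 (Fin 2 → ℝ)).symm
    ![Real.cos θ * x 0 - Real.sin θ * x 1, Real.sin θ * x 0 + Real.cos θ * x 1]

/-- The class 𝒟_p: simply connected bounded Lipschitz planar domains with rotational
symmetry of order p about the origin, together with a nonnegative rotationally
symmetric L^∞ weight on the boundary that is positive on a set of positive H¹ measure. -/
def MemDp (p : ℕ) (Ω : Set E2) (ρ : E2 → ℝ) : Prop :=
  IsLipschitzDomain Ω ∧ SimplyConnectedSpace Ω ∧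
  rotBy (2 * Real.pi / p) '' Ω = Ω ∧
  (∀ x, 0 ≤ ρ x) ∧
  (∃ C : ℝ, ∀ᵐ x ∂(μH[1].restrict (frontier Ω)), ρ x ≤ C) ∧
  0 < μH[1] {x ∈ frontier Ω | 0 < ρ x} ∧
  (∀ x ∈ frontier Ω, ρ (rotBy (2 * Real.pi / p) x) = ρ x)

/-- The ρ-weighted length L_ρ(∂Ω). -/
def Lweight (Ω : Set E2) (ρ : E2 → ℝ) : ℝ≥0∞ :=
  ∫⁻ x in frontier Ω, ENNReal.ofReal (ρ x) ∂μH[1]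

/-- Σ_k^p, the supremum of the normalized k-th Steklov eigenvalue over 𝒟_p. -/
def SigmaP (p k : ℕ) : ℝ≥0∞ :=
  ⨆ (Ω : Set E2) (ρ : E2 → ℝ) (_ : MemDp p Ω ρ), steklovW Ω ρ k * Lweight Ω ρ

instance fact_two_pi_pos : Fact (0 < 2 * Real.pi) := ⟨Real.two_pi_pos⟩

/-- The standard isometry between the complex numbers and the Euclidean plane. -/
def complexIsoE2 : ℂ ≃ₗᵢ[ℝ] E2 := Complex.orthonormalBasisOneI.repr

lemma complexIsoE2_apply_zero (z : ℂ) : complexIsoE2 z 0 = z.re := by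
  simp [complexIsoE2, Complex.orthonormalBasisOneI_repr_apply]

lemma complexIsoE2_apply_one (z : ℂ) : complexIsoE2 z 1 = z.im := by
  simp [complexIsoE2, Complex.orthonormalBasisOneI_repr_apply]

/-- The parametrization of the unit circle of the plane by the additive circle. -/
def circleParam (x : AddCircle (2 * Real.pi)) : E2 := complexIsoE2 (AddCircle.toCircle x : ℂ)

lemma circleParam_coe (θ : ℝ) :
    circleParam (θ : AddCircle (2 * Real.pi)) = complexIsoE2 (Complex.exp (θ * Complex.I)) := by
  have : 2 * Real.pi / (2 * Real.pi) * θ = θ := by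
    field_simp
  rw [circleParam, AddCircle.toCircle_apply_mk, this, Circle.coe_exp]

lemma continuous_circleParam : Continuous circleParam :=
  complexIsoE2.continuous.comp (continuous_subtype_val.comp AddCircle.continuous_toCircle)

lemma injective_circleParam : Function.Injective circleParam := by
  intro x y h
  have h1 := complexIsoE2.injective h
  exact AddCircle.injective_toCircle Real.two_pi_pos.ne' (Subtype.ext h1)

lemma measurableEmbedding_circleParam : MeasurableEmbedding circleParam :=
  (continuous_circleParam.isClosedEmbedding injective_circleParam).measurableEmbedding

lemma range_circleParam : range circleParam = sphere 0 1 := by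
  ext x
  constructor
  · rintro ⟨y, rfl⟩
    simpa [circleParam] using Circle.norm_coe _
  · intro hx
    have h1 : ‖complexIsoE2.symm x‖ = 1 := by simpa using hx
    obtain ⟨y, hy⟩ := (AddCircle.homeomorphCircle').surjective
      ⟨complexIsoE2.symm x, mem_sphere_zero_iff_norm.2 h1⟩
    refine ⟨y, ?_⟩
    induction y using QuotientAddGroup.induction_on with
    | H θ =>
      have h2 := congrArg (fun c : Circle => (c : ℂ)) hy
      erw [AddCircle.homeomorphCircle'_apply_mk] at h2
      simp only [Circle.coe_exp] at h2
      erw [circleParam_coe]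
      rw [h2]
      simp

lemma circleParam_add (a x : AddCircle (2 * Real.pi)) :
    circleParam (a + x) =
      (complexIsoE2.symm.trans ((rotation (AddCircle.toCircle a)).trans complexIsoE2))
        (circleParam x) := by
  simp [circleParam, AddCircle.toCircle_add, rotation_apply]

lemma hausdorffMeasure_sphere_ne_zero : μH[1] (sphere (0 : E2) 1) ≠ 0 := by
  intro h
  have hL : LipschitzWith 1 (fun x : E2 => x 0) := by
    refine LipschitzWith.of_dist_le_mul fun x y => ?_
    rw [NNReal.coe_one, one_mul, dist_eq_norm, dist_eq_norm]
    exact PiLp.norm_apply_le (x - y) 0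
  have h1 := hL.hausdorffMeasure_image_le (d := 1) zero_le_one (sphere (0 : E2) 1)
  rw [h, mul_zero, hausdorffMeasure_real] at h1
  have h2 : Icc (-1 : ℝ) 1 ⊆ (fun x : E2 => x 0) '' sphere (0 : E2) 1 := by
    intro s hs
    refine ⟨complexIsoE2 (Complex.exp (Real.arccos s * Complex.I)), ?_, ?_⟩
    · simp
    · simp only [complexIsoE2_apply_zero, Complex.exp_ofReal_mul_I_re]
      exact Real.cos_arccos hs.1 hs.2
  have h3 := (measure_mono h2).trans h1
  norm_num [Real.volume_Icc] at h3

lemma hausdorffMeasure_sphere_ne_top : μH[1] (sphere (0 : E2) 1) ≠ ⊤ := by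
  have hL : LipschitzWith 1 (fun θ : ℝ => complexIsoE2 (Complex.exp (θ * Complex.I))) := by
    refine LipschitzWith.of_dist_le_mul fun x y => ?_
    rw [NNReal.coe_one, one_mul, LinearIsometryEquiv.dist_map]
    have h := Convex.norm_image_sub_le_of_norm_hasDerivWithin_le
      (f := fun θ : ℝ => Complex.exp (θ * Complex.I)) (s := univ) (C := 1)
      (f' := fun θ : ℝ => Complex.exp (θ * Complex.I) * (1 * Complex.I))
      (x := y) (y := x) ?_ ?_ convex_univ trivial trivial
    · simpa [dist_eq_norm] using h
    · intro θ _
      exact (((Complex.ofRealCLM.hasDerivAt (x := θ)).mul_const Complex.I).cexp).hasDerivWithinAt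
    · intro θ _
      simp
  have h1 := hL.hausdorffMeasure_image_le (d := 1) zero_le_one (Icc 0 (2 * Real.pi))
  have h2 : sphere (0 : E2) 1 ⊆
      (fun θ : ℝ => complexIsoE2 (Complex.exp (θ * Complex.I))) '' Icc 0 (2 * Real.pi) := by
    rw [← range_circleParam]
    rintro _ ⟨y, rfl⟩
    have hy : y ∈ (QuotientAddGroup.mk : ℝ → AddCircle (2 * Real.pi)) ''
        Icc 0 (0 + 2 * Real.pi) := by
      rw [AddCircle.coe_image_Icc_eq]
      trivial
    obtain ⟨θ, hθ, rfl⟩ := hy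
    exact ⟨θ, by simpa using hθ, (circleParam_coe θ).symm⟩
  refine ne_top_of_le_ne_top ?_ ((measure_mono h2).trans h1)
  rw [hausdorffMeasure_real]
  simp [Real.volume_Icc, ENNReal.mul_eq_top]

lemma exists_lintegral_sphere_eq : ∃ κ : ℝ≥0∞, κ ≠ 0 ∧ κ ≠ ⊤ ∧ ∀ G : E2 → ℝ≥0∞, Measurable G →
    ∫⁻ x in sphere (0 : E2) 1, G x ∂μH[1] =
      κ * ∫⁻ θ in Ioc (-Real.pi) Real.pi, G (complexIsoE2 (Complex.exp (θ * Complex.I))) := by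
  set ν : Measure (AddCircle (2 * Real.pi)) := Measure.comap circleParam μH[1] with hν
  have happ : ∀ s, ν s = μH[1] (circleParam '' s) :=
    fun s => measurableEmbedding_circleParam.comap_apply _ _
  have huniv : ν univ = μH[1] (sphere (0 : E2) 1) := by
    rw [happ, image_univ, range_circleParam]
  have : IsFiniteMeasure ν := ⟨by rw [huniv]; exact hausdorffMeasure_sphere_ne_top.lt_top⟩
  have : ν.IsAddLeftInvariant := by
    refine ⟨fun a => Measure.ext fun s hs => ?_⟩
    rw [Measure.map_apply (measurable_const_add a) hs, happ, happ]
    set R := (complexIsoE2.symm.trans ((rotation (AddCircle.toCircle a)).trans complexIsoE2))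
    have : circleParam '' s = R '' (circleParam '' ((fun x => a + x) ⁻¹' s)) := by
      ext x
      simp only [mem_image, mem_preimage, exists_exists_and_eq_and]
      constructor
      · rintro ⟨y, hy, rfl⟩
        refine ⟨-a + y, by simpa using hy, ?_⟩
        rw [← circleParam_add]
        simp
      · rintro ⟨y, hy, rfl⟩
        exact ⟨a + y, hy, circleParam_add a y⟩
    rw [this]
    exact (R.isometry.hausdorffMeasure_image (Or.inl zero_le_one) _).symm
  have hc := Measure.isAddInvariant_eq_smul_of_compactSpace ν volume
  set c := ν.addHaarScalarFactor volume
  refine ⟨c, ?_, ENNReal.coe_ne_top, fun G hG => ?_⟩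
  · intro h0
    rw [ENNReal.coe_eq_zero] at h0
    rw [h0, zero_smul] at hc
    rw [hc] at huniv
    exact hausdorffMeasure_sphere_ne_zero huniv.symm
  · have h1 : ∫⁻ x in sphere (0 : E2) 1, G x ∂μH[1] = ∫⁻ y, G (circleParam y) ∂ν := by
      rw [← measurableEmbedding_circleParam.lintegral_map, hν,
        measurableEmbedding_circleParam.map_comap, range_circleParam]
    have h2 := AddCircle.lintegral_preimage (2 * Real.pi) (-Real.pi) (fun y => G (circleParam y))
    rw [show -Real.pi + 2 * Real.pi = Real.pi by ring] at h2
    simp only [circleParam_coe] at h2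
    rw [h1, h2, hc, lintegral_smul_measure]
    rfl

lemma lipschitzOnWith_neg_sqrt_one_sub_sq :
    LipschitzOnWith 1 (fun s : ℝ => -√(1 - s ^ 2)) (Icc (-(1 / 2)) (1 / 2)) := by
  refine LipschitzOnWith.of_dist_le_mul fun s hs t ht => ?_
  rw [NNReal.coe_one, one_mul, Real.dist_eq, Real.dist_eq]
  obtain ⟨hs1, hs2⟩ := hs
  obtain ⟨ht1, ht2⟩ := ht
  have hs3 : 0 ≤ 1 - s ^ 2 := by nlinarith
  have ht3 : 0 ≤ 1 - t ^ 2 := by nlinarith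
  have hs4 : 1 / 2 ≤ √(1 - s ^ 2) := Real.le_sqrt_of_sq_le (by nlinarith)
  have ht4 : 1 / 2 ≤ √(1 - t ^ 2) := Real.le_sqrt_of_sq_le (by nlinarith)
  have hs5 := Real.sq_sqrt hs3
  have ht5 := Real.sq_sqrt ht3
  set a := √(1 - s ^ 2)
  set b := √(1 - t ^ 2)
  have key : (-a - -b) * (a + b) = (s - t) * (s + t) := by linear_combination ht5 - hs5
  have h1 : |-a - -b| * (a + b) = |s - t| * |s + t| := by
    rw [← abs_mul, ← key, abs_mul, abs_of_pos (by linarith : (0 : ℝ) < a + b)]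
  have h2 : |s + t| ≤ 1 := abs_le.2 ⟨by linarith, by linarith⟩
  nlinarith [abs_nonneg (-a - -b), abs_nonneg (s - t)]

lemma mem_unit_ball_iff (x : E2) : x ∈ ball (0 : E2) 1 ↔ x 0 ^ 2 + x 1 ^ 2 < 1 := by
  rw [mem_ball_zero_iff, EuclideanSpace.norm_eq, Real.sqrt_lt' one_pos]
  simp

lemma isLipschitzDomain_unit_ball : IsLipschitzDomain (ball (0 : E2) 1) := by
  refine ⟨isOpen_ball, (convex_ball _ _).isConnected ⟨0, by simp⟩, isBounded_ball, ?_⟩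
  intro q hq
  rw [frontier_ball _ one_ne_zero, mem_sphere_zero_iff_norm] at hq
  obtain ⟨φ, hφ, hφ'⟩ := lipschitzOnWith_neg_sqrt_one_sub_sq.extend_real
  set w : E2 := complexIsoE2 (-Complex.I) with hw
  have hqw : ‖q‖ = ‖w‖ := by rw [hq, hw]; simp
  set e : E2 ≃ₗᵢ[ℝ] E2 := (ℝ ∙ (q - w))ᗮ.reflection
  have heq : e q = w := Submodule.reflection_sub hqw
  refine ⟨e, 1, φ, {x | |e x 0| < 1 / 2 ∧ e x 1 < 0}, hφ, ?_, ?_, ?_⟩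
  · have := e.continuous
    exact (isOpen_lt (by fun_prop) continuous_const).and (isOpen_lt (by fun_prop) continuous_const)
  · simp [heq, hw, complexIsoE2_apply_zero, complexIsoE2_apply_one]
  · rintro x ⟨hx0, hx1⟩
    have hx : x ∈ ball (0 : E2) 1 ↔ e x ∈ ball (0 : E2) 1 := by simp
    have hs := abs_lt.1 hx0
    rw [hx, mem_unit_ball_iff, ← hφ' ⟨hs.1.le, hs.2.le⟩]
    have h0 : 0 ≤ 1 - e x 0 ^ 2 := by nlinarith
    rw [neg_lt, Real.lt_sqrt (by linarith)]
    constructor <;> intro h <;> nlinarith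

lemma rotBy_complexIsoE2 (θ : ℝ) (z : ℂ) :
    rotBy θ (complexIsoE2 z) = complexIsoE2 (Complex.exp (θ * Complex.I) * z) := by
  ext i
  fin_cases i <;>
  simp [rotBy, complexIsoE2_apply_zero, complexIsoE2_apply_one, Complex.exp_ofReal_mul_I_re,
    Complex.exp_ofReal_mul_I_im, -Complex.ofReal_cos, -Complex.ofReal_sin]
  ring

lemma rotBy_image_unit_ball (θ : ℝ) : rotBy θ '' ball (0 : E2) 1 = ball 0 1 := by
  ext x
  constructor
  · rintro ⟨y, hy, rfl⟩
    obtain ⟨z, rfl⟩ := complexIsoE2.surjective y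
    rw [rotBy_complexIsoE2]
    simpa using hy
  · intro hx
    obtain ⟨z, rfl⟩ := complexIsoE2.surjective x
    refine ⟨complexIsoE2 (Complex.exp ((-θ : ℝ) * Complex.I) * z), ?_, ?_⟩
    · simpa [-Complex.ofReal_neg, Complex.norm_exp_ofReal_mul_I] using hx
    rw [rotBy_complexIsoE2, ← mul_assoc, ← Complex.exp_add]
    simp

lemma memDp_unit_ball {p : ℕ} {w : ℂ → ℝ} (hw : Continuous w) (hpos : ∀ z, 0 < w z)
    (hrot : ∀ z, w (Complex.exp ((2 * Real.pi / p : ℝ) * Complex.I) * z) = w z) :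
    MemDp p (ball (0 : E2) 1) (fun x => w (complexIsoE2.symm x)) := by
  have hfr : frontier (ball (0 : E2) 1) = sphere 0 1 := frontier_ball _ one_ne_zero
  refine ⟨isLipschitzDomain_unit_ball, ?_, rotBy_image_unit_ball _, fun x => (hpos _).le,
    ?_, ?_, ?_⟩
  · have := (convex_ball (0 : E2) 1).contractibleSpace ⟨0, by simp⟩
    infer_instance
  · obtain ⟨C, hC⟩ := (isCompact_sphere (0 : E2) 1).bddAbove_image
      (hw.comp complexIsoE2.symm.continuous).continuousOn
    refine ⟨C, ?_⟩
    rw [hfr]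
    filter_upwards [ae_restrict_mem isClosed_sphere.measurableSet] with x hx
    exact hC ⟨x, hx, rfl⟩
  · simp only [hpos, and_true, ofPred_mem_eq, hfr]
    exact pos_iff_ne_zero.2 hausdorffMeasure_sphere_ne_zero
  · intro x _
    obtain ⟨z, rfl⟩ := complexIsoE2.surjective x
    rw [rotBy_complexIsoE2]
    simp only [LinearIsometryEquiv.symm_apply_apply]
    exact hrot z

/-- The (unnormalized) cosine Fourier coefficient of a function on `[-π, π]`. -/
def cosCoeff (F : ℝ → ℝ) (n : ℕ) : ℝ := ∫ θ in (-Real.pi)..Real.pi, F θ * Real.cos (n * θ)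

/-- The (unnormalized) sine Fourier coefficient of a function on `[-π, π]`. -/
def sinCoeff (F : ℝ → ℝ) (n : ℕ) : ℝ := ∫ θ in (-Real.pi)..Real.pi, F θ * Real.sin (n * θ)

lemma integral_mul_exp_mul_I {F : ℝ → ℝ} (hF : Continuous F) (n : ℕ) :
    ∫ θ in (-Real.pi)..Real.pi, (F θ : ℂ) * Complex.exp (n * θ * Complex.I) =
      cosCoeff F n + sinCoeff F n * Complex.I := by
  have h : ∀ θ : ℝ, (F θ : ℂ) * Complex.exp (n * θ * Complex.I) =
      ((F θ * Real.cos (n * θ) : ℝ) : ℂ) + ((F θ * Real.sin (n * θ) : ℝ) : ℂ) * Complex.I := by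
    intro θ
    rw [Complex.exp_mul_I]
    push_cast
    ring
  simp_rw [h]
  rw [intervalIntegral.integral_add, intervalIntegral.integral_mul_const,
    intervalIntegral.integral_ofReal, intervalIntegral.integral_ofReal]
  · rfl
  · exact Continuous.intervalIntegrable (by fun_prop) _ _
  · exact Continuous.intervalIntegrable (by fun_prop) _ _

lemma integral_mul_exp_neg_mul_I {F : ℝ → ℝ} (hF : Continuous F) (n : ℕ) :
    ∫ θ in (-Real.pi)..Real.pi, (F θ : ℂ) * Complex.exp (-(n * θ * Complex.I)) =
      cosCoeff F n - sinCoeff F n * Complex.I := by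
  have h : ∀ θ : ℝ, (F θ : ℂ) * Complex.exp (-(n * θ * Complex.I)) =
      ((F θ * Real.cos (n * θ) : ℝ) : ℂ) - ((F θ * Real.sin (n * θ) : ℝ) : ℂ) * Complex.I := by
    intro θ
    rw [← neg_mul, Complex.exp_mul_I, Complex.cos_neg, Complex.sin_neg]
    push_cast
    ring
  simp_rw [h]
  rw [intervalIntegral.integral_sub, intervalIntegral.integral_mul_const,
    intervalIntegral.integral_ofReal, intervalIntegral.integral_ofReal]
  · rfl
  · exact Continuous.intervalIntegrable (by fun_prop) _ _
  · exact Continuous.intervalIntegrable (by fun_prop) _ _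

lemma norm_sq_add_mul_I (a b : ℝ) : ‖(a : ℂ) + b * Complex.I‖ ^ 2 = a ^ 2 + b ^ 2 := by
  rw [← Complex.normSq_eq_norm_sq, Complex.normSq_add_mul_I]

lemma norm_sq_sub_mul_I (a b : ℝ) : ‖(a : ℂ) - b * Complex.I‖ ^ 2 = a ^ 2 + b ^ 2 := by
  have := norm_sq_add_mul_I a (-b)
  push_cast at this
  rw [neg_mul, ← sub_eq_add_neg] at this
  rw [this]
  ring

lemma hasSum_cosCoeff_sinCoeff {F : ℝ → ℝ} (hF : Continuous F) :
    HasSum (fun n : ℕ => 2 * (cosCoeff F n ^ 2 + sinCoeff F n ^ 2))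
      (2 * Real.pi * (∫ θ in (-Real.pi)..Real.pi, F θ ^ 2) + cosCoeff F 0 ^ 2) := by
  have hab : -Real.pi < Real.pi := by linarith [Real.pi_pos]
  have hT : Real.pi - -Real.pi = 2 * Real.pi := by ring
  have hmem : MemLp (fun θ => (F θ : ℂ)) 2 (volume.restrict (Ioc (-Real.pi) Real.pi)) := by
    have hc : Continuous (fun θ => (F θ : ℂ)) := by fun_prop
    obtain ⟨C, hC⟩ := (isCompact_Icc (a := -Real.pi) (b := Real.pi)).exists_bound_of_continuousOn
      hc.continuousOn
    refine MemLp.of_bound hc.aestronglyMeasurable C ?_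
    filter_upwards [ae_restrict_mem measurableSet_Ioc] with x hx
    exact hC x ⟨hx.1.le, hx.2⟩
  have h := (hasSum_sq_fourierCoeffOn hab hmem).nat_add_neg
  have hcoef : ∀ n : ℤ, fourierCoeffOn hab (fun θ => (F θ : ℂ)) n =
      (1 / (2 * Real.pi)) • ∫ θ in (-Real.pi)..Real.pi,
        (F θ : ℂ) * Complex.exp (-(n * θ * Complex.I)) := by
    intro n
    rw [fourierCoeffOn_eq_integral, hT]
    congr 1
    refine intervalIntegral.integral_congr fun θ _ => ?_
    simp only [fourier_coe_apply, smul_eq_mul]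
    rw [mul_comm]
    congr 2
    have : (Real.pi : ℂ) ≠ 0 := by exact_mod_cast Real.pi_ne_zero
    push_cast
    field_simp
  have hpos : ∀ n : ℕ, ‖fourierCoeffOn hab (fun θ => (F θ : ℂ)) n‖ ^ 2 =
      (1 / (2 * Real.pi)) ^ 2 * (cosCoeff F n ^ 2 + sinCoeff F n ^ 2) := by
    intro n
    rw [hcoef]
    have := integral_mul_exp_neg_mul_I hF n
    push_cast
    rw [this, norm_smul, mul_pow, norm_sq_sub_mul_I, Real.norm_eq_abs, sq_abs]
  have hneg : ∀ n : ℕ, ‖fourierCoeffOn hab (fun θ => (F θ : ℂ)) (-n)‖ ^ 2 =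
      (1 / (2 * Real.pi)) ^ 2 * (cosCoeff F n ^ 2 + sinCoeff F n ^ 2) := by
    intro n
    rw [hcoef]
    have := integral_mul_exp_mul_I hF n
    push_cast
    simp only [neg_mul, neg_neg]
    rw [this, norm_smul, mul_pow, norm_sq_add_mul_I, Real.norm_eq_abs, sq_abs]
  have hz : sinCoeff F 0 = 0 := by simp [sinCoeff]
  have h0 := hpos 0
  rw [Nat.cast_zero, hz] at h0
  simp only [hpos, hneg, h0, hT] at h
  have h2 := h.mul_left ((2 * Real.pi) ^ 2)
  have hpi := Real.pi_ne_zero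
  have e1 : ∀ x : ℝ, (2 * Real.pi) ^ 2 * ((1 / (2 * Real.pi)) ^ 2 * x +
      (1 / (2 * Real.pi)) ^ 2 * x) = 2 * x := by
    intro x
    field_simp
    ring
  have e2 : ∀ x y : ℝ, (2 * Real.pi) ^ 2 * ((2 * Real.pi)⁻¹ * x +
      (1 / (2 * Real.pi)) ^ 2 * (y ^ 2 + 0 ^ 2)) = 2 * Real.pi * x + y ^ 2 := by
    intro x y
    field_simp
    ring
  simpa only [Complex.norm_real, Real.norm_eq_abs, sq_abs, smul_eq_mul, e1, e2] using h2

lemma hasDerivAt_exp_mul_I (θ : ℝ) :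
    HasDerivAt (fun t : ℝ => Complex.exp (t * Complex.I))
      (Complex.exp (θ * Complex.I) * Complex.I) θ := by
  have h := ((Complex.ofRealCLM.hasDerivAt (x := θ)).mul_const Complex.I).cexp
  simpa using h

lemma hasDerivAt_mul_exp_pow (γ : ℂ) (n : ℕ) (θ : ℝ) :
    HasDerivAt (fun t : ℝ => γ * Complex.exp (t * Complex.I) ^ (n + 1))
      ((n + 1) * Complex.I * (γ * Complex.exp (θ * Complex.I) ^ (n + 1))) θ := by
  refine (((hasDerivAt_exp_mul_I θ).pow (n + 1)).const_mul γ).congr_deriv ?_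
  push_cast
  ring

lemma setIntegral_unit_ball_eq_polar (h : ℂ → ℝ) :
    ∫ z in ball (0 : ℂ) 1, h z =
      ∫ q in Icc ((0 : ℝ), -Real.pi) (1, Real.pi),
        q.1 * h (q.1 * Complex.exp (q.2 * Complex.I)) := by
  have hsymm : ∀ q : ℝ × ℝ, Complex.polarCoord.symm q = q.1 * Complex.exp (q.2 * Complex.I) := by
    intro q
    rw [Complex.polarCoord_symm_apply, Complex.exp_mul_I]
    push_cast
    rfl
  rw [← integral_indicator measurableSet_ball, ← Complex.integral_comp_polarCoord_symm,
    polarCoord_target]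
  have hA : MeasurableSet {q : ℝ × ℝ | q.1 < 1} := measurableSet_lt measurable_fst measurable_const
  have h1 : ∀ q ∈ Ioi (0 : ℝ) ×ˢ Ioo (-Real.pi) Real.pi,
      q.1 • (ball (0 : ℂ) 1).indicator h (Complex.polarCoord.symm q) =
      {q : ℝ × ℝ | q.1 < 1}.indicator
        (fun q => q.1 * h (q.1 * Complex.exp (q.2 * Complex.I))) q := by
    rintro q ⟨hq, -⟩
    have hq' : (0 : ℝ) < q.1 := hq
    have hm : (q.1 : ℂ) * Complex.exp (q.2 * Complex.I) ∈ ball (0 : ℂ) 1 ↔ q.1 < 1 := by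
      rw [mem_ball_zero_iff, norm_mul, Complex.norm_exp_ofReal_mul_I, mul_one, Complex.norm_real,
        Real.norm_of_nonneg hq'.le]
    rw [hsymm]
    by_cases hlt : q.1 < 1
    · rw [indicator_of_mem (hm.2 hlt), indicator_of_mem (by exact hlt), smul_eq_mul]
    · rw [indicator_of_notMem (by rwa [hm]), indicator_of_notMem (by exact hlt), smul_zero]
  rw [setIntegral_congr_fun (measurableSet_Ioi.prod measurableSet_Ioo) h1,
    setIntegral_indicator hA]
  apply setIntegral_congr_set
  have h2 : Ioi (0 : ℝ) ×ˢ Ioo (-Real.pi) Real.pi ∩ {q : ℝ × ℝ | q.1 < 1} =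
      Ioo 0 1 ×ˢ Ioo (-Real.pi) Real.pi := by
    ext q
    simp only [mem_inter_iff, mem_prod, mem_Ioi, mem_Ioo, mem_ofPred_eq]
    tauto
  rw [h2, Icc_prod_eq]
  exact Measure.set_prod_ae_eq Ioo_ae_eq_Icc Ioo_ae_eq_Icc

lemma fderiv_conj_mul_pow (D : ℂ →L[ℝ] ℝ) (γ : ℂ) (n : ℕ) (r θ : ℝ) :
    D ((starRingEnd ℂ) (γ * ((n + 1) * (r * Complex.exp (θ * Complex.I)) ^ n))) =
      (n + 1) * r ^ n * ((γ * Complex.exp (θ * Complex.I) ^ (n + 1)).re *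
          D (Complex.exp (θ * Complex.I)) -
        (γ * Complex.exp (θ * Complex.I) ^ (n + 1)).im *
          D (Complex.exp (θ * Complex.I) * Complex.I)) := by
  set e := Complex.exp (θ * Complex.I) with he
  have hee : e * (starRingEnd ℂ) e = 1 := by
    rw [Complex.mul_conj, Complex.normSq_eq_norm_sq, he, Complex.norm_exp_ofReal_mul_I]
    norm_num
  set w := γ * e ^ (n + 1) with hw
  have hconj : (starRingEnd ℂ) w = (w.re : ℂ) - w.im * Complex.I := by
    apply Complex.ext <;> simp
  have h1 : (starRingEnd ℂ) (γ * ((n + 1) * (r * e) ^ n)) =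
      ((n + 1) * r ^ n * w.re : ℝ) • e - ((n + 1) * r ^ n * w.im : ℝ) • (e * Complex.I) := by
    have h2 : (starRingEnd ℂ) (γ * ((n + 1) * (r * e) ^ n)) =
        (n + 1) * r ^ n * (e * (starRingEnd ℂ) w) := by
      rw [hw]
      simp only [map_mul, map_add, map_pow, map_one, Complex.conj_ofReal, map_natCast]
      linear_combination (-(n + 1) * r ^ n * (starRingEnd ℂ) γ * (starRingEnd ℂ) e ^ n) * hee
    rw [h2, hconj, Complex.real_smul, Complex.real_smul]
    push_cast
    ring
  rw [h1, map_sub, map_smul, map_smul, smul_eq_mul, smul_eq_mul]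
  ring

lemma integral_fderiv_conj_mul_pow {f : ℂ → ℝ} (hf : ContDiff ℝ 1 f) (γ : ℂ) (n : ℕ) :
    ∫ z in ball (0 : ℂ) 1, fderiv ℝ f z ((starRingEnd ℂ) (γ * ((n + 1) * z ^ n))) =
      (n + 1) * ∫ θ in (-Real.pi)..Real.pi, f (Complex.exp (θ * Complex.I)) *
        (γ * Complex.exp (θ * Complex.I) ^ (n + 1)).re := by
  rw [setIntegral_unit_ball_eq_polar]
  set G : ℝ × ℝ → ℝ := fun q => f (q.1 * Complex.exp (q.2 * Complex.I)) with hG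
  set W : ℝ → ℂ := fun θ => γ * Complex.exp (θ * Complex.I) ^ (n + 1) with hW
  set A : ℝ × ℝ → ℝ := fun q => (n + 1) * (q.1 ^ (n + 1) * ((W q.2).re * G q)) with hA
  set B : ℝ × ℝ → ℝ := fun q => -((n + 1) * (q.1 ^ n * ((W q.2).im * G q))) with hB
  have hofReal : ContDiff ℝ 1 (fun t : ℝ => (t : ℂ)) := Complex.ofRealCLM.contDiff
  have hexp : ContDiff ℝ 1 (fun t : ℝ => Complex.exp (t * Complex.I)) :=
    (hofReal.mul contDiff_const).cexp
  have hGc : ContDiff ℝ 1 G :=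
    hf.comp ((hofReal.comp contDiff_fst).mul (hexp.comp contDiff_snd))
  have hWc : ContDiff ℝ 1 W := contDiff_const.mul (hexp.pow _)
  have hWre : ContDiff ℝ 1 (fun t => (W t).re) := Complex.reCLM.contDiff.comp hWc
  have hWim : ContDiff ℝ 1 (fun t => (W t).im) := Complex.imCLM.contDiff.comp hWc
  have hAc : ContDiff ℝ 1 A := contDiff_const.mul
    ((contDiff_fst.pow _).mul ((hWre.comp contDiff_snd).mul hGc))
  have hBc : ContDiff ℝ 1 B := (contDiff_const.mul
    ((contDiff_fst.pow _).mul ((hWim.comp contDiff_snd).mul hGc))).neg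
  have hfd : ∀ z, HasFDerivAt f (fderiv ℝ f z) z := fun z =>
    (hf.differentiable one_ne_zero z).hasFDerivAt
  have hA' : ∀ q : ℝ × ℝ, fderiv ℝ A q (1, 0) =
      (n + 1) * ((n + 1) * q.1 ^ n * ((W q.2).re * G q) + q.1 ^ (n + 1) * ((W q.2).re *
        fderiv ℝ f (q.1 * Complex.exp (q.2 * Complex.I)) (Complex.exp (q.2 * Complex.I)))) := by
    rintro ⟨r, θ⟩
    have h1 : HasDerivAt (fun s : ℝ => A (s, θ)) (fderiv ℝ A (r, θ) (1, 0)) r :=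
      ((hAc.differentiable one_ne_zero _).hasFDerivAt).comp_hasDerivAt r
        ((hasDerivAt_id r).prodMk (hasDerivAt_const r θ))
    have h2 : HasDerivAt (fun s : ℝ => G (s, θ))
        (fderiv ℝ f (r * Complex.exp (θ * Complex.I)) (Complex.exp (θ * Complex.I))) r := by
      refine (hfd _).comp_hasDerivAt r ?_
      simpa using (Complex.ofRealCLM.hasDerivAt (x := r)).mul_const (Complex.exp (θ * Complex.I))
    have h3 := ((hasDerivAt_pow (n + 1) r).mul (h2.const_mul (W θ).re)).const_mul ((n : ℝ) + 1)
    rw [h1.unique h3]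
    push_cast
    rfl
  have hB' : ∀ q : ℝ × ℝ, fderiv ℝ B q (0, 1) =
      -((n + 1) * (q.1 ^ n * (((n + 1) * (W q.2).re) * G q + (W q.2).im *
        (q.1 * fderiv ℝ f (q.1 * Complex.exp (q.2 * Complex.I))
          (Complex.exp (q.2 * Complex.I) * Complex.I))))) := by
    rintro ⟨r, θ⟩
    have h1 : HasDerivAt (fun s : ℝ => B (r, s)) (fderiv ℝ B (r, θ) (0, 1)) θ :=
      ((hBc.differentiable one_ne_zero _).hasFDerivAt).comp_hasDerivAt θ
        ((hasDerivAt_const θ r).prodMk (hasDerivAt_id θ))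
    have h2 : HasDerivAt (fun s : ℝ => G (r, s))
        (r * fderiv ℝ f (r * Complex.exp (θ * Complex.I))
          (Complex.exp (θ * Complex.I) * Complex.I)) θ := by
      have h4 := (hfd (r * Complex.exp (θ * Complex.I))).comp_hasDerivAt θ
        ((hasDerivAt_exp_mul_I θ).const_mul (r : ℂ))
      rwa [← Complex.real_smul (x := r) (z := _ * Complex.I), map_smul, smul_eq_mul] at h4
    have hW' : W θ = γ * Complex.exp (θ * Complex.I) ^ (n + 1) := rfl
    have h5 : HasDerivAt (fun s : ℝ => (W s).im) ((n + 1) * (W θ).re) θ := by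
      have h6 := Complex.imCLM.hasFDerivAt.comp_hasDerivAt θ (hasDerivAt_mul_exp_pow γ n θ)
      refine h6.congr_deriv ?_
      rw [Complex.imCLM_apply, ← hW']
      simp
    have h3 := (((h5.mul h2).const_mul (r ^ n)).const_mul ((n : ℝ) + 1)).neg
    rw [h1.unique h3]
  have key : ∀ q : ℝ × ℝ, q.1 * fderiv ℝ f (q.1 * Complex.exp (q.2 * Complex.I))
      ((starRingEnd ℂ) (γ * ((n + 1) * (q.1 * Complex.exp (q.2 * Complex.I)) ^ n))) =
      fderiv ℝ A q (1, 0) + fderiv ℝ B q (0, 1) := by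
    intro q
    rw [fderiv_conj_mul_pow, hA', hB']
    ring
  simp_rw [key]
  have hle : ((0 : ℝ), -Real.pi) ≤ (1, Real.pi) := ⟨zero_le_one, by
    linarith [Real.pi_pos]⟩
  rw [integral_divergence_prod_Icc_of_hasFDerivAt_of_le A B (fderiv ℝ A) (fderiv ℝ B)
    (0, -Real.pi) (1, Real.pi) hle hAc.continuous.continuousOn hBc.continuous.continuousOn
    (fun x _ => (hAc.differentiable one_ne_zero _).hasFDerivAt)
    (fun x _ => (hBc.differentiable one_ne_zero _).hasFDerivAt)]
  · have hneg : Complex.exp (((-Real.pi : ℝ) : ℂ) * Complex.I) = -1 := by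
      rw [Complex.ofReal_neg, neg_mul, Complex.exp_neg, Complex.exp_pi_mul_I]
      norm_num
    have hBB : ∀ x : ℝ, B (x, Real.pi) = B (x, -Real.pi) := by
      intro x
      simp only [hB, hG, hW, hneg, Complex.exp_pi_mul_I]
    simp only [hBB, sub_self, zero_add]
    have h0 : ∀ y : ℝ, A (0, y) = 0 := by simp [hA]
    have h1 : ∀ y : ℝ, A (1, y) = (n + 1) * (f (Complex.exp (y * Complex.I)) * (W y).re) := by
      intro y
      simp only [hA, hG, one_pow, one_mul, Complex.ofReal_one]
      ring
    simp only [h0, h1, intervalIntegral.integral_zero, sub_zero]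
    rw [intervalIntegral.integral_const_mul]
  · have c1 : Continuous (fun x => fderiv ℝ A x (1, 0) + fderiv ℝ B x (0, 1)) :=
      ((hAc.continuous_fderiv one_ne_zero).clm_apply continuous_const).add
        ((hBc.continuous_fderiv one_ne_zero).clm_apply continuous_const)
    exact c1.continuousOn.integrableOn_compact isCompact_Icc

lemma integral_cos_int_mul (m : ℤ) :
    ∫ θ in (-Real.pi)..Real.pi, Real.cos (m * θ) = if m = 0 then 2 * Real.pi else 0 := by
  split_ifs with h
  · simp [h]
    ring
  · have hm : (m : ℝ) ≠ 0 := by exact_mod_cast h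
    rw [intervalIntegral.integral_comp_mul_left _ hm, integral_cos, mul_neg, Real.sin_neg,
      Real.sin_int_mul_pi]
    simp

lemma integral_sin_int_mul (m : ℤ) :
    ∫ θ in (-Real.pi)..Real.pi, Real.sin (m * θ) = 0 := by
  by_cases h : m = 0
  · simp [h]
  · have hm : (m : ℝ) ≠ 0 := by exact_mod_cast h
    rw [intervalIntegral.integral_comp_mul_left _ hm, integral_sin, mul_neg, Real.cos_neg, sub_self,
      smul_zero]

lemma integral_trig_mul_trig (a b c d : ℝ) (k n : ℕ) (hk : k ≠ 0) :
    ∫ θ in (-Real.pi)..Real.pi, (a * Real.cos (k * θ) + b * Real.sin (k * θ)) *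
        (c * Real.cos (n * θ) + d * Real.sin (n * θ)) =
      if k = n then Real.pi * (a * c + b * d) else 0 := by
  have h : ∀ θ : ℝ, (a * Real.cos (k * θ) + b * Real.sin (k * θ)) *
        (c * Real.cos (n * θ) + d * Real.sin (n * θ)) =
      ((a * c + b * d) / 2 * Real.cos (((k - n : ℤ) : ℝ) * θ) +
        (a * c - b * d) / 2 * Real.cos (((k + n : ℤ) : ℝ) * θ)) +
      ((a * d + b * c) / 2 * Real.sin (((k + n : ℤ) : ℝ) * θ) +
        (b * c - a * d) / 2 * Real.sin (((k - n : ℤ) : ℝ) * θ)) := by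
    intro θ
    push_cast
    rw [add_mul (k : ℝ) (n : ℝ) θ, sub_mul (k : ℝ) (n : ℝ) θ, Real.cos_sub, Real.cos_add,
      Real.sin_add, Real.sin_sub]
    ring
  simp_rw [h]
  have hi : ∀ g : ℝ → ℝ, Continuous g → IntervalIntegrable g volume (-Real.pi) Real.pi :=
    fun g hg => hg.intervalIntegrable _ _
  rw [intervalIntegral.integral_add (hi _ (by fun_prop)) (hi _ (by fun_prop)),
    intervalIntegral.integral_add (hi _ (by fun_prop)) (hi _ (by fun_prop)),
    intervalIntegral.integral_add (hi _ (by fun_prop)) (hi _ (by fun_prop))]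
  simp only [intervalIntegral.integral_const_mul, integral_cos_int_mul, integral_sin_int_mul]
  rw [if_neg (by omega : ¬ ((k : ℤ) + n = 0))]
  by_cases hkn : k = n
  · rw [if_pos (by omega), if_pos hkn]
    ring
  · rw [if_neg (by omega), if_neg hkn]
    ring

lemma re_mul_exp_pow (a b : ℝ) (n : ℕ) (θ : ℝ) :
    (((a - b * Complex.I : ℂ)) * Complex.exp (θ * Complex.I) ^ n).re =
      a * Real.cos (n * θ) + b * Real.sin (n * θ) := by
  rw [← Complex.exp_nat_mul, ← mul_assoc]
  have : (n : ℂ) * θ = ((n * θ : ℝ) : ℂ) := by push_cast; rfl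
  rw [this, Complex.mul_re, Complex.exp_ofReal_mul_I_re, Complex.exp_ofReal_mul_I_im]
  simp

lemma sum_le_pi_mul_dirichlet {f : ℂ → ℝ} (hf : ContDiff ℝ 1 f) {F : ℝ → ℝ}
    (hF : ∀ θ : ℝ, F θ = f (Complex.exp (θ * Complex.I))) (N : ℕ) :
    ∑ n ∈ Finset.range N, ((n : ℝ) + 1) * (cosCoeff F (n + 1) ^ 2 + sinCoeff F (n + 1) ^ 2) ≤
      Real.pi * ∫ z in ball (0 : ℂ) 1, ‖fderiv ℝ f z‖ ^ 2 := by
  have hFc : Continuous F := by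
    have : F = fun θ : ℝ => f (Complex.exp (θ * Complex.I)) := funext hF
    rw [this]
    have := hf.continuous
    fun_prop
  set a : ℕ → ℝ := fun n => cosCoeff F (n + 1)
  set b : ℕ → ℝ := fun n => sinCoeff F (n + 1)
  set γ : ℕ → ℂ := fun n => (a n - b n * Complex.I)
  set v : ℂ → ℂ := fun z => ∑ n ∈ Finset.range N, (starRingEnd ℂ) (γ n * ((n + 1) * z ^ n)) with hv
  set U : ℂ → ℂ := fun z => ∑ n ∈ Finset.range N, γ n * z ^ (n + 1) with hU
  set u : ℂ → ℝ := fun z => (U z).re with hu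
  have hvc : Continuous v := by
    refine continuous_finsetSum _ fun n _ => Complex.continuous_conj.comp ?_
    fun_prop
  have hU' : ∀ z, HasDerivAt U ((starRingEnd ℂ) (v z)) z := by
    intro z
    have h1 : HasDerivAt U (∑ n ∈ Finset.range N, γ n * (((n + 1 : ℕ) : ℂ) * z ^ n)) z := by
      refine HasDerivAt.fun_sum fun n _ => ?_
      exact (hasDerivAt_pow (n + 1) z).const_mul (γ n)
    convert h1 using 1
    simp [hv]
  have hu' : ∀ z w, fderiv ℝ u z w = ((starRingEnd ℂ) (v z) * w).re := by
    intro z w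
    have h1 : HasFDerivAt u _ z :=
      Complex.reCLM.hasFDerivAt.comp z ((hU' z).hasFDerivAt.restrictScalars ℝ)
    rw [h1.fderiv]
    simp [mul_comm]
  have huc : ContDiff ℝ 1 u := by
    refine Complex.reCLM.contDiff.comp ?_
    refine ContDiff.sum fun n _ => ?_
    fun_prop
  have hint : ∀ g : ℂ → ℝ, Continuous g → IntegrableOn g (ball (0 : ℂ) 1) volume := fun g hg =>
    (hg.continuousOn.integrableOn_compact (isCompact_closedBall 0 1)).mono_set
      ball_subset_closedBall
  have hI : ∀ g : ℂ → ℝ, ContDiff ℝ 1 g → ∫ z in ball (0 : ℂ) 1, fderiv ℝ g z (v z) =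
      ∑ n ∈ Finset.range N, ((n : ℝ) + 1) * ∫ θ in (-Real.pi)..Real.pi,
        g (Complex.exp (θ * Complex.I)) *
          (a n * Real.cos ((n + 1 : ℕ) * θ) + b n * Real.sin ((n + 1 : ℕ) * θ)) := by
    intro g hg
    have h1 : ∀ z, fderiv ℝ g z (v z) = ∑ n ∈ Finset.range N,
        fderiv ℝ g z ((starRingEnd ℂ) (γ n * ((n + 1) * z ^ n))) := fun z => by
      rw [hv, map_sum]
    simp_rw [h1]
    rw [integral_finsetSum]
    · refine Finset.sum_congr rfl fun n _ => ?_
      rw [integral_fderiv_conj_mul_pow hg]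
      congr 1
      refine intervalIntegral.integral_congr fun θ _ => ?_
      simp only [γ]
      rw [re_mul_exp_pow]
    · intro n _
      refine hint _ ((hg.continuous_fderiv one_ne_zero).clm_apply ?_)
      exact Complex.continuous_conj.comp (by fun_prop)
  have hIf : ∫ z in ball (0 : ℂ) 1, fderiv ℝ f z (v z) =
      ∑ n ∈ Finset.range N, ((n : ℝ) + 1) * (a n ^ 2 + b n ^ 2) := by
    rw [hI f hf]
    refine Finset.sum_congr rfl fun n _ => ?_
    congr 1
    have h1 : ∀ θ : ℝ, f (Complex.exp (θ * Complex.I)) *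
        (a n * Real.cos ((n + 1 : ℕ) * θ) + b n * Real.sin ((n + 1 : ℕ) * θ)) =
        a n * (F θ * Real.cos ((n + 1 : ℕ) * θ)) + b n * (F θ * Real.sin ((n + 1 : ℕ) * θ)) := by
      intro θ
      rw [← hF]
      ring
    simp_rw [h1]
    rw [intervalIntegral.integral_add (Continuous.intervalIntegrable (by fun_prop) _ _)
      (Continuous.intervalIntegrable (by fun_prop) _ _), intervalIntegral.integral_const_mul,
      intervalIntegral.integral_const_mul]
    change a n * a n + b n * b n = _
    ring
  have hIu : ∫ z in ball (0 : ℂ) 1, fderiv ℝ u z (v z) =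
      Real.pi * ∑ n ∈ Finset.range N, ((n : ℝ) + 1) * (a n ^ 2 + b n ^ 2) := by
    rw [hI u huc, Finset.mul_sum]
    refine Finset.sum_congr rfl fun n hn => ?_
    have h1 : ∀ θ : ℝ, u (Complex.exp (θ * Complex.I)) *
        (a n * Real.cos ((n + 1 : ℕ) * θ) + b n * Real.sin ((n + 1 : ℕ) * θ)) =
        ∑ k ∈ Finset.range N,
          (a k * Real.cos ((k + 1 : ℕ) * θ) + b k * Real.sin ((k + 1 : ℕ) * θ)) *
          (a n * Real.cos ((n + 1 : ℕ) * θ) + b n * Real.sin ((n + 1 : ℕ) * θ)) := by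
      intro θ
      rw [← Finset.sum_mul, hu, hU]
      simp only [Complex.re_sum, γ, re_mul_exp_pow]
    simp_rw [h1]
    rw [intervalIntegral.integral_finsetSum
      (fun k _ => Continuous.intervalIntegrable (by fun_prop) _ _)]
    simp_rw [integral_trig_mul_trig _ _ _ _ _ _ (Nat.succ_ne_zero _), Nat.succ_inj]
    rw [Finset.sum_ite_eq' _ _ _, if_pos hn]
    ring
  have hpt : ∀ z, 2 * Real.pi⁻¹ * fderiv ℝ f z (v z) - (Real.pi⁻¹) ^ 2 * fderiv ℝ u z (v z) ≤
      ‖fderiv ℝ f z‖ ^ 2 := by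
    intro z
    have h1 : fderiv ℝ u z (v z) = ‖v z‖ ^ 2 := by
      rw [hu', mul_comm, Complex.mul_conj, Complex.ofReal_re, Complex.normSq_eq_norm_sq]
    have h2 : fderiv ℝ f z (v z) ≤ ‖fderiv ℝ f z‖ * ‖v z‖ :=
      (le_abs_self _).trans ((fderiv ℝ f z).le_opNorm _)
    have h3 : 0 ≤ Real.pi⁻¹ := inv_nonneg.2 Real.pi_pos.le
    rw [h1]
    nlinarith [sq_nonneg (‖fderiv ℝ f z‖ - Real.pi⁻¹ * ‖v z‖), mul_le_mul_of_nonneg_left h2 h3]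
  have hcf : Continuous (fun z => fderiv ℝ f z (v z)) :=
    (hf.continuous_fderiv one_ne_zero).clm_apply hvc
  have hcu : Continuous (fun z => fderiv ℝ u z (v z)) :=
    (huc.continuous_fderiv one_ne_zero).clm_apply hvc
  have hmono : ∫ z in ball (0 : ℂ) 1, (2 * Real.pi⁻¹ * fderiv ℝ f z (v z) -
      (Real.pi⁻¹) ^ 2 * fderiv ℝ u z (v z)) ≤ ∫ z in ball (0 : ℂ) 1, ‖fderiv ℝ f z‖ ^ 2 :=
    setIntegral_mono (hint _ ((hcf.const_mul (2 * Real.pi⁻¹)).sub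
      (hcu.const_mul ((Real.pi⁻¹) ^ 2))))
    (hint _ ((hf.continuous_fderiv one_ne_zero).norm.pow 2)) hpt
  rw [integral_sub (hint _ (hcf.const_mul _)) (hint _ (hcu.const_mul _)), integral_const_mul,
    integral_const_mul, hIf, hIu] at hmono
  have hpi := Real.pi_pos
  have h4 := mul_le_mul_of_nonneg_left hmono hpi.le
  refine le_trans (le_of_eq ?_) h4
  change ∑ n ∈ Finset.range N, ((n : ℝ) + 1) * (a n ^ 2 + b n ^ 2) = _
  field_simp
  ring

lemma mul_integral_sq_le {f : ℂ → ℝ} (hf : ContDiff ℝ 1 f) {F : ℝ → ℝ}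
    (hF : ∀ θ : ℝ, F θ = f (Complex.exp (θ * Complex.I))) (M : ℕ) :
    M * (Real.pi * ∫ θ in (-Real.pi)..Real.pi, F θ ^ 2) ≤
      Real.pi * (∫ z in ball (0 : ℂ) 1, ‖fderiv ℝ f z‖ ^ 2) +
        ∑ n ∈ Finset.range M, ((M : ℝ) - n) * (cosCoeff F n ^ 2 + sinCoeff F n ^ 2) := by
  have hFc : Continuous F := by
    have : F = fun θ : ℝ => f (Complex.exp (θ * Complex.I)) := funext hF
    rw [this]
    have := hf.continuous
    fun_prop
  set s : ℕ → ℝ := fun n => cosCoeff F n ^ 2 + sinCoeff F n ^ 2 with hs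
  have hs0 : ∀ n, 0 ≤ s n := fun n => by positivity
  have hpartial : ∀ j, (M : ℝ) * ∑ n ∈ Finset.range (M + (j + 1)), 2 * s n ≤
      2 * (Real.pi * (∫ z in ball (0 : ℂ) 1, ‖fderiv ℝ f z‖ ^ 2) +
        ∑ n ∈ Finset.range M, ((M : ℝ) - n) * s n) := by
    intro j
    have h1 : ∑ n ∈ Finset.range (M + (j + 1)), (n : ℝ) * s n ≤
        Real.pi * ∫ z in ball (0 : ℂ) 1, ‖fderiv ℝ f z‖ ^ 2 := by
      rw [← add_assoc, Finset.sum_range_succ']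
      simpa [hs] using sum_le_pi_mul_dirichlet hf hF (M + j)
    have h2 : ∑ n ∈ Finset.range (M + (j + 1)), ((M : ℝ) - n) * s n ≤
        ∑ n ∈ Finset.range M, ((M : ℝ) - n) * s n := by
      rw [Finset.sum_range_add]
      refine add_le_of_nonpos_right (Finset.sum_nonpos fun n _ => ?_)
      refine mul_nonpos_of_nonpos_of_nonneg ?_ (hs0 _)
      push_cast
      linarith [n.cast_nonneg (α := ℝ)]
    have h3 : (M : ℝ) * ∑ n ∈ Finset.range (M + (j + 1)), 2 * s n =
        2 * (∑ n ∈ Finset.range (M + (j + 1)), (n : ℝ) * s n +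
          ∑ n ∈ Finset.range (M + (j + 1)), ((M : ℝ) - n) * s n) := by
      rw [← Finset.sum_add_distrib, Finset.mul_sum, Finset.mul_sum]
      refine Finset.sum_congr rfl fun n _ => ?_
      ring
    linarith
  have hsum : HasSum (fun n => 2 * s n)
      (2 * Real.pi * (∫ θ in (-Real.pi)..Real.pi, F θ ^ 2) + cosCoeff F 0 ^ 2) :=
    hasSum_cosCoeff_sinCoeff hFc
  have hlim := hsum.tendsto_sum_nat.const_mul (M : ℝ)
  have hle := le_of_tendsto hlim (eventually_atTop.2 ⟨M + 1, fun N hN => by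
    obtain ⟨j, rfl⟩ := Nat.exists_eq_add_of_le hN
    have := hpartial j
    rwa [show M + 1 + j = M + (j + 1) by ring]⟩)
  have h0 : 0 ≤ (M : ℝ) * cosCoeff F 0 ^ 2 := by positivity
  linarith

/-- The trigonometric system `1, sin θ, cos θ, sin (2θ), cos (2θ), …`. -/
def trigFun (i : ℕ) (θ : ℝ) : ℝ :=
  if Even i then Real.cos ((i / 2 : ℕ) * θ) else Real.sin (((i + 1) / 2 : ℕ) * θ)

lemma continuous_trigFun (i : ℕ) : Continuous (trigFun i) := by
  unfold trigFun
  split_ifs <;> fun_prop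

lemma integral_mul_trigFun_two_mul (F : ℝ → ℝ) (n : ℕ) :
    ∫ θ in (-Real.pi)..Real.pi, F θ * trigFun (2 * n) θ = cosCoeff F n := by
  simp [trigFun, cosCoeff]

lemma integral_mul_trigFun_two_mul_add_one (F : ℝ → ℝ) (n : ℕ) :
    ∫ θ in (-Real.pi)..Real.pi, F θ * trigFun (2 * n + 1) θ = sinCoeff F (n + 1) := by
  have h1 : ¬ Even (2 * n + 1) := by simp
  have h2 : (2 * n + 1 + 1) / 2 = n + 1 := by omega
  simp [trigFun, sinCoeff, h1, h2]

lemma sinCoeff_zero (F : ℝ → ℝ) : sinCoeff F 0 = 0 := by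
  simp [sinCoeff]

lemma dirEnergy_unit_ball {f : E2 → ℝ} (hf : ContDiff ℝ 1 f) :
    dirEnergy (ball 0 1) f =
      ENNReal.ofReal (∫ z in ball (0 : ℂ) 1, ‖fderiv ℝ (f ∘ complexIsoE2) z‖ ^ 2) := by
  have hg : ContDiff ℝ 1 (f ∘ complexIsoE2) :=
    hf.comp complexIsoE2.toContinuousLinearEquiv.contDiff
  have hint : IntegrableOn (fun z => ‖fderiv ℝ (f ∘ complexIsoE2) z‖ ^ 2) (ball (0 : ℂ) 1) :=
    (((hg.continuous_fderiv one_ne_zero).norm.pow 2).continuousOn.integrableOn_compact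
      (isCompact_closedBall 0 1)).mono_set ball_subset_closedBall
  rw [ofReal_integral_eq_lintegral_ofReal hint (ae_of_all _ fun z => by positivity), dirEnergy,
    ← complexIsoE2.measurePreserving.setLIntegral_comp_preimage_emb
      complexIsoE2.toHomeomorph.measurableEmbedding]
  have hpre : complexIsoE2 ⁻¹' ball (0 : E2) 1 = ball 0 1 := by
    rw [complexIsoE2.preimage_ball, map_zero]
  rw [hpre]
  refine lintegral_congr fun z => ?_
  have hn : ‖fderiv ℝ (f ∘ complexIsoE2) z‖ = ‖fderiv ℝ f (complexIsoE2 z)‖ := by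
    have h1 := complexIsoE2.toContinuousLinearEquiv.comp_right_fderiv (f := f) (x := z)
    exact (congrArg norm h1).trans
      (ContinuousLinearMap.opNorm_comp_linearIsometryEquiv _ complexIsoE2)
  rw [hn, ENNReal.ofReal_pow (norm_nonneg _), ofReal_norm, enorm_eq_nnnorm]

lemma eqOn_const_of_dirEnergy_unit_ball_eq_zero {f : E2 → ℝ} (hf : ContDiff ℝ 1 f)
    (h : dirEnergy (ball 0 1) f = 0) : EqOn f (fun _ => f 0) (closedBall 0 1) := by
  have hc : Continuous (fderiv ℝ f) := hf.continuous_fderiv one_ne_zero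
  have hm : Measurable (fun x => (‖fderiv ℝ f x‖₊ : ℝ≥0∞) ^ 2) :=
    (ENNReal.continuous_coe.comp hc.nnnorm).measurable.pow_const 2
  have h1 : fderiv ℝ f =ᵐ[volume.restrict (ball (0 : E2) 1)] 0 := by
    filter_upwards [(lintegral_eq_zero_iff hm).1 h] with x hx
    simpa using hx
  have h2 : EqOn (fderiv ℝ f) 0 (ball 0 1) :=
    Measure.eqOn_open_of_ae_eq h1 isOpen_ball hc.continuousOn continuousOn_const
  have h3 : EqOn f (fun _ => f 0) (ball 0 1) := fun x hx =>
    isOpen_ball.is_const_of_fderiv_eq_zero (convex_ball (0 : E2) 1).isPreconnected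
      (hf.differentiable one_ne_zero).differentiableOn h2 hx (mem_ball_self one_pos)
  rw [← closure_ball (0 : E2) one_ne_zero]
  exact h3.closure hf.continuous continuous_const

lemma lintegral_Ioc_ofReal {g : ℝ → ℝ} (hg : Continuous g) (h0 : ∀ θ, 0 ≤ g θ) :
    ∫⁻ θ in Ioc (-Real.pi) Real.pi, ENNReal.ofReal (g θ) =
      ENNReal.ofReal (∫ θ in (-Real.pi)..Real.pi, g θ) := by
  rw [intervalIntegral.integral_of_le (by linarith [Real.pi_pos]),
    ofReal_integral_eq_lintegral_ofReal _ (ae_of_all _ h0)]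
  exact (hg.continuousOn.integrableOn_compact isCompact_Icc).mono_set Ioc_subset_Icc_self

theorem ofReal_le_sigmaP {p k : ℕ} (hp : 0 < p) (hk : p ≤ k) {w : ℂ → ℝ} (hw : Continuous w)
    (hpos : ∀ z, 0 < w z)
    (hrot : ∀ z, w (Complex.exp ((2 * Real.pi / p : ℝ) * Complex.I) * z) = w z)
    {c : ℝ} (hc : 0 ≤ c)
    (H : ∀ (f : ℂ → ℝ) (F : ℝ → ℝ), ContDiff ℝ 1 f → Continuous F →
      (∀ θ : ℝ, F θ = f (Complex.exp (θ * Complex.I))) →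
      (∀ i < p, ∫ θ in (-Real.pi)..Real.pi, F θ * trigFun i θ = 0) →
      c * ∫ θ in (-Real.pi)..Real.pi, w (Complex.exp (θ * Complex.I)) * F θ ^ 2 ≤
        ∫ z in ball (0 : ℂ) 1, ‖fderiv ℝ f z‖ ^ 2) :
    ENNReal.ofReal (c * ∫ θ in (-Real.pi)..Real.pi, w (Complex.exp (θ * Complex.I))) ≤
      SigmaP p k := by
  obtain ⟨κ, hκ0, hκt, hκ⟩ := exists_lintegral_sphere_eq
  set ρ : E2 → ℝ := fun x => w (complexIsoE2.symm x) with hρ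
  have hρc : Continuous ρ := hw.comp complexIsoE2.symm.continuous
  have hfr : frontier (ball (0 : E2) 1) = sphere 0 1 := frontier_ball _ one_ne_zero
  have hcl : closure (ball (0 : E2) 1) = closedBall 0 1 := closure_ball _ one_ne_zero
  have hec : Continuous (fun θ : ℝ => Complex.exp (θ * Complex.I)) := by fun_prop
  have hL : Lweight (ball 0 1) ρ =
      κ * ENNReal.ofReal (∫ θ in (-Real.pi)..Real.pi, w (Complex.exp (θ * Complex.I))) := by
    rw [Lweight, hfr, hκ (fun x => ENNReal.ofReal (ρ x))
      (ENNReal.measurable_ofReal.comp hρc.measurable)]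
    simp only [hρ, LinearIsometryEquiv.symm_apply_apply]
    exact congrArg (κ * ·) (lintegral_Ioc_ofReal (hw.comp hec) fun θ => (hpos _).le)
  have hσ : ENNReal.ofReal c / κ ≤ steklovW (ball 0 1) ρ k := by
    refine le_iInf₂ fun V hV => le_iInf₂ fun hsmooth _ => le_iInf fun hinj => ?_
    have hfd : FiniteDimensional ℝ V := FiniteDimensional.of_finrank_pos (by omega)
    have hsm : ∀ f ∈ V, ContDiff ℝ 1 f := fun f hf => (hsmooth f hf).of_le (by simp)
    have hcirc : ∀ f ∈ V, Continuous
        (fun θ : ℝ => f (complexIsoE2 (Complex.exp (θ * Complex.I)))) := fun f hf =>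
      (hsm f hf).continuous.comp (complexIsoE2.continuous.comp hec)
    have hii : ∀ f ∈ V, ∀ i, IntervalIntegrable (fun θ : ℝ =>
        f (complexIsoE2 (Complex.exp (θ * Complex.I))) * trigFun i θ) volume
        (-Real.pi) Real.pi := fun f hf i =>
      ((hcirc f hf).mul (continuous_trigFun i)).intervalIntegrable _ _
    let T : V →ₗ[ℝ] (Fin p → ℝ) :=
      { toFun := fun f i => ∫ θ in (-Real.pi)..Real.pi,
          (f : E2 → ℝ) (complexIsoE2 (Complex.exp (θ * Complex.I))) * trigFun i θ
        map_add' := fun f g => by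
          funext i
          simp only [Submodule.coe_add, Pi.add_apply, add_mul]
          exact intervalIntegral.integral_add (hii f f.2 i) (hii g g.2 i)
        map_smul' := fun a f => by
          funext i
          simp only [Submodule.coe_smul, Pi.smul_apply, smul_eq_mul, mul_assoc, RingHom.id_apply]
          exact intervalIntegral.integral_const_mul _ _ }
    have hker : LinearMap.ker T ≠ ⊥ := LinearMap.ker_ne_bot_of_finrank_lt (by
      rw [hV, Module.finrank_fin_fun]
      omega)
    obtain ⟨⟨f, hfV⟩, hfT, hf0⟩ := (Submodule.ne_bot_iff _).1 hker
    have horth : ∀ i < p, ∫ θ in (-Real.pi)..Real.pi,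
        f (complexIsoE2 (Complex.exp (θ * Complex.I))) * trigFun i θ = 0 := fun i hi =>
      congrFun (LinearMap.mem_ker.1 hfT) ⟨i, hi⟩
    have hne : ¬ EqOn f 0 (closure (ball 0 1)) := fun h =>
      hf0 (Subtype.ext (hinj f hfV h))
    refine le_iSup₂_of_le f hfV (le_iSup_of_le hne ?_)
    have hE : dirEnergy (ball 0 1) f ≠ 0 := by
      intro h
      have hconst := eqOn_const_of_dirEnergy_unit_ball_eq_zero (hsm f hfV) h
      have h0 := horth 0 hp
      have h1 : ∀ θ : ℝ, f (complexIsoE2 (Complex.exp (θ * Complex.I))) = f 0 := fun θ =>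
        hconst (by simp [Complex.norm_exp_ofReal_mul_I])
      simp only [h1, trigFun] at h0
      have h2 : f 0 = 0 := by simpa [Real.pi_ne_zero] using h0
      rw [hcl] at hne
      exact hne fun x hx => (hconst hx).trans h2
    have hb : bdryInt (frontier (ball 0 1)) ρ f = κ * ENNReal.ofReal
        (∫ θ in (-Real.pi)..Real.pi, w (Complex.exp (θ * Complex.I)) *
          f (complexIsoE2 (Complex.exp (θ * Complex.I))) ^ 2) := by
      rw [bdryInt, hfr, hκ (fun x => ENNReal.ofReal (ρ x * f x ^ 2))
        (ENNReal.measurable_ofReal.comp (hρc.mul ((hsm f hfV).continuous.pow 2)).measurable)]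
      simp only [hρ, LinearIsometryEquiv.symm_apply_apply]
      exact congrArg (κ * ·) (lintegral_Ioc_ofReal ((hw.comp hec).mul ((hcirc f hfV).pow 2))
        fun θ => mul_nonneg (hpos _).le (sq_nonneg _))
    have hbt : bdryInt (frontier (ball 0 1)) ρ f ≠ ⊤ := by
      rw [hb]
      exact ENNReal.mul_ne_top hκt ENNReal.ofReal_ne_top
    rw [rayleigh, ENNReal.le_div_iff_mul_le (Or.inr hE) (Or.inl hbt), hb, ← mul_assoc,
      ENNReal.div_mul_cancel hκ0 hκt, ← ENNReal.ofReal_mul hc, dirEnergy_unit_ball (hsm f hfV)]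
    exact ENNReal.ofReal_le_ofReal (H _ _
      ((hsm f hfV).comp complexIsoE2.toContinuousLinearEquiv.contDiff) (hcirc f hfV)
      (fun θ => rfl) horth)
  calc ENNReal.ofReal (c * ∫ θ in (-Real.pi)..Real.pi, w (Complex.exp (θ * Complex.I)))
      = ENNReal.ofReal c / κ * Lweight (ball 0 1) ρ := by
        rw [hL, ← mul_assoc, ENNReal.div_mul_cancel hκ0 hκt, ENNReal.ofReal_mul hc]
    _ ≤ steklovW (ball 0 1) ρ k * Lweight (ball 0 1) ρ := by gcongr
    _ ≤ SigmaP p k := le_iSup₂_of_le (ball 0 1) ρ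
        (le_iSup_of_le (memDp_unit_ball hw hpos hrot) le_rfl)

lemma dirichlet_ge_of_orthogonal_odd {f : ℂ → ℝ} {F : ℝ → ℝ} (hf : ContDiff ℝ 1 f)
    (hF : ∀ θ : ℝ, F θ = f (Complex.exp (θ * Complex.I))) (j : ℕ)
    (h0 : ∀ i < 2 * j + 1, ∫ θ in (-Real.pi)..Real.pi, F θ * trigFun i θ = 0) :
    ((j : ℝ) + 1) * ∫ θ in (-Real.pi)..Real.pi, F θ ^ 2 ≤
      ∫ z in ball (0 : ℂ) 1, ‖fderiv ℝ f z‖ ^ 2 := by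
  have hcos : ∀ n ≤ j, cosCoeff F n = 0 := fun n hn => by
    rw [← integral_mul_trigFun_two_mul, h0 _ (by omega)]
  have hsin : ∀ n ≤ j, sinCoeff F n = 0 := fun n hn => by
    cases n with
    | zero => exact sinCoeff_zero F
    | succ n => rw [← integral_mul_trigFun_two_mul_add_one, h0 _ (by omega)]
  have h := mul_integral_sq_le hf hF (j + 1)
  rw [Finset.sum_eq_zero fun n hn => by
    have hn' : n ≤ j := Nat.lt_succ_iff.1 (Finset.mem_range.1 hn)
    rw [hcos n hn', hsin n hn']
    ring, add_zero, mul_left_comm] at h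
  have h2 := le_of_mul_le_mul_left h Real.pi_pos
  exact_mod_cast h2

lemma dirichlet_ge_of_orthogonal_even {f : ℂ → ℝ} {F : ℝ → ℝ} (hf : ContDiff ℝ 1 f)
    (hF : ∀ θ : ℝ, F θ = f (Complex.exp (θ * Complex.I))) (j : ℕ)
    (h0 : ∀ i < 2 * j + 2, ∫ θ in (-Real.pi)..Real.pi, F θ * trigFun i θ = 0) :
    ((j : ℝ) + 2) * (∫ θ in (-Real.pi)..Real.pi, F θ ^ 2) ≤
      (∫ z in ball (0 : ℂ) 1, ‖fderiv ℝ f z‖ ^ 2) + cosCoeff F (j + 1) ^ 2 / Real.pi := by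
  have hcos : ∀ n ≤ j, cosCoeff F n = 0 := fun n hn => by
    rw [← integral_mul_trigFun_two_mul, h0 _ (by omega)]
  have hsin : ∀ n ≤ j + 1, sinCoeff F n = 0 := fun n hn => by
    cases n with
    | zero => exact sinCoeff_zero F
    | succ n => rw [← integral_mul_trigFun_two_mul_add_one, h0 _ (by omega)]
  have h := mul_integral_sq_le hf hF (j + 2)
  rw [Finset.sum_range_succ, Finset.sum_eq_zero fun n hn => by
    have hn' : n ≤ j := Nat.lt_succ_iff.1 (Finset.mem_range.1 hn)
    rw [hcos n hn', hsin n (by omega)]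
    ring, hsin _ le_rfl] at h
  have hpi := Real.pi_pos
  refine le_of_mul_le_mul_left ?_ hpi
  rw [mul_add, mul_div_cancel₀ _ hpi.ne']
  push_cast at h
  linarith

lemma integral_sin_sq_mul_sq_le {F : ℝ → ℝ} (hF : Continuous F) {m : ℕ} (hm : m ≠ 0) :
    ∫ θ in (-Real.pi)..Real.pi, Real.sin (m * θ) ^ 2 * F θ ^ 2 ≤
      3 / 8 * (cosCoeff F m ^ 2 / Real.pi) +
        3 * ((∫ θ in (-Real.pi)..Real.pi, F θ ^ 2) - cosCoeff F m ^ 2 / Real.pi) := by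
  have hpi := Real.pi_pos
  set b := cosCoeff F m / Real.pi with hb
  have hpt : ∀ θ : ℝ, Real.sin (m * θ) ^ 2 * F θ ^ 2 ≤
      (3 / 16 * b ^ 2 * (1 - Real.cos ((4 * m : ℤ) * θ)) + 3 * F θ ^ 2) +
        (3 / 2 * b ^ 2 * (1 + Real.cos ((2 * m : ℤ) * θ)) -
          6 * b * (F θ * Real.cos (m * θ))) := by
    intro θ
    have h4 : Real.cos ((4 * m : ℤ) * θ) = 2 * Real.cos ((2 * m : ℤ) * θ) ^ 2 - 1 := by
      rw [← Real.cos_two_mul]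
      push_cast
      ring_nf
    have h2 : Real.cos ((2 * m : ℤ) * θ) = 2 * Real.cos (m * θ) ^ 2 - 1 := by
      rw [← Real.cos_two_mul]
      push_cast
      ring_nf
    rw [h4, h2]
    have hsc := Real.sin_sq_add_cos_sq (m * θ)
    set s := Real.sin (m * θ)
    set c := Real.cos (m * θ)
    have hs : s ^ 2 = 1 - c ^ 2 := by linarith
    rw [hs]
    have hs0 : 0 ≤ 1 - c ^ 2 := hs ▸ sq_nonneg s
    nlinarith [mul_nonneg hs0 (sq_nonneg (b * c - 2 * (F θ - b * c))),
      mul_nonneg (sq_nonneg c) (sq_nonneg (F θ - b * c))]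
  have hi : ∀ g : ℝ → ℝ, Continuous g → IntervalIntegrable g volume (-Real.pi) Real.pi :=
    fun g hg => hg.intervalIntegrable _ _
  refine (intervalIntegral.integral_mono (by linarith) (hi _ (by fun_prop)) (hi _ (by fun_prop))
    hpt).trans (le_of_eq ?_)
  rw [intervalIntegral.integral_add (hi _ (by fun_prop)) (hi _ (by fun_prop)),
    intervalIntegral.integral_add (hi _ (by fun_prop)) (hi _ (by fun_prop)),
    intervalIntegral.integral_sub (hi _ (by fun_prop)) (hi _ (by fun_prop))]
  simp only [intervalIntegral.integral_const_mul]
  rw [intervalIntegral.integral_sub (hi _ (by fun_prop)) (hi _ (by fun_prop)),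
    intervalIntegral.integral_add (hi _ (by fun_prop)) (hi _ (by fun_prop)),
    integral_cos_int_mul, integral_cos_int_mul, if_neg (by omega), if_neg (by omega)]
  change _ + _ + (_ - 6 * b * cosCoeff F m) = _
  have hbm : cosCoeff F m = b * Real.pi := by rw [hb, div_mul_cancel₀ _ hpi.ne']
  rw [hbm, intervalIntegral.integral_const, smul_eq_mul]
  field_simp
  ring

lemma integral_sin_sq_nat_mul {m : ℕ} (hm : m ≠ 0) :
    ∫ θ in (-Real.pi)..Real.pi, Real.sin (m * θ) ^ 2 = Real.pi := by
  have h := integral_trig_mul_trig 0 1 0 1 m m hm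
  simpa [← pow_two] using h

theorem ofReal_lt_sigmaP_odd (j k : ℕ) (hk : 2 * j + 1 ≤ k) :
    ENNReal.ofReal (((2 * j + 1 : ℕ) : ℝ) * Real.pi) < SigmaP (2 * j + 1) k := by
  have h := ofReal_le_sigmaP (p := 2 * j + 1) (k := k) (w := fun _ => 1) (c := (j : ℝ) + 1)
    (by omega) hk continuous_const (fun _ => one_pos) (fun _ => rfl) (by positivity)
    (fun f F hf _ hF h0 => by simpa using dirichlet_ge_of_orthogonal_odd hf hF j h0)
  refine lt_of_lt_of_le ?_ h
  rw [ENNReal.ofReal_lt_ofReal_iff']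
  have hpi := Real.pi_pos
  rw [intervalIntegral.integral_const, smul_eq_mul]
  push_cast
  constructor
  · nlinarith
  · ring_nf
    positivity

theorem ofReal_lt_sigmaP_even (j k : ℕ) (hk : 2 * j + 2 ≤ k) :
    ENNReal.ofReal (((2 * j + 2 : ℕ) : ℝ) * Real.pi) < SigmaP (2 * j + 2) k := by
  have hpi := Real.pi_pos
  set m : ℝ := (j : ℝ) + 1 with hm
  have hm1 : 0 < m := by positivity
  set t : ℝ := 1 / (3 * m) with ht
  have ht0 : 0 < t := by positivity
  have htm : t * (3 * m) = 1 := by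
    rw [ht]
    field_simp
  set c : ℝ := m / (1 + 3 / 8 * t) with hc
  have hc0 : 0 < c := by positivity
  have hct : c * (1 + 3 / 8 * t) = m := div_mul_cancel₀ _ (by positivity)
  set w : ℂ → ℝ := fun z => 1 + t * (z ^ (j + 1)).im ^ 2 with hw
  have hwθ : ∀ θ : ℝ, w (Complex.exp (θ * Complex.I)) =
      1 + t * Real.sin ((j + 1 : ℕ) * θ) ^ 2 := by
    intro θ
    simp only [hw]
    rw [← Complex.exp_nat_mul, ← mul_assoc]
    have : ((j + 1 : ℕ) : ℂ) * θ = (((j + 1 : ℕ) * θ : ℝ) : ℂ) := by push_cast; rfl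
    rw [this, Complex.exp_ofReal_mul_I_im]
  have hi : ∀ g : ℝ → ℝ, Continuous g → IntervalIntegrable g volume (-Real.pi) Real.pi :=
    fun g hg => hg.intervalIntegrable _ _
  have hwc : Continuous w := by
    have : Continuous fun z : ℂ => (z ^ (j + 1)).im :=
      Complex.continuous_im.comp (continuous_pow _)
    fun_prop
  have h := ofReal_le_sigmaP (p := 2 * j + 2) (k := k) (w := w) (c := c)
    (by omega) hk hwc (fun _ => by positivity) (fun z => by
      have h1 : Complex.exp ((2 * Real.pi / (2 * j + 2 : ℕ) : ℝ) * Complex.I) ^ (j + 1) = -1 := by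
        rw [← Complex.exp_nat_mul, ← Complex.exp_pi_mul_I]
        congr 1
        have : (j : ℂ) + 1 ≠ 0 := by exact_mod_cast Nat.succ_ne_zero j
        push_cast
        field_simp
      simp only [hw]
      rw [mul_pow, h1]
      simp) hc0.le (fun f F hf hFc hF h0 => by
    have hE := dirichlet_ge_of_orthogonal_even hf hF j h0
    have hS := integral_sin_sq_mul_sq_le hFc (Nat.succ_ne_zero j)
    have hS0 : 0 ≤ (∫ θ in (-Real.pi)..Real.pi, F θ ^ 2) - cosCoeff F (j + 1) ^ 2 / Real.pi := by
      have hsum := le_hasSum (hasSum_cosCoeff_sinCoeff hFc) (j + 1) fun n _ => by positivity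
      rw [← integral_mul_trigFun_two_mul F 0, h0 _ (by omega)] at hsum
      rw [sub_nonneg, div_le_iff₀' hpi]
      nlinarith [sq_nonneg (sinCoeff F (j + 1))]
    have hW : ∫ θ in (-Real.pi)..Real.pi, w (Complex.exp (θ * Complex.I)) * F θ ^ 2 =
        (∫ θ in (-Real.pi)..Real.pi, F θ ^ 2) +
          t * ∫ θ in (-Real.pi)..Real.pi, Real.sin ((j + 1 : ℕ) * θ) ^ 2 * F θ ^ 2 := by
      simp only [hwθ, add_mul, one_mul, mul_assoc]
      rw [intervalIntegral.integral_add (hi _ (by fun_prop)) (hi _ (by fun_prop)),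
        intervalIntegral.integral_const_mul]
    rw [hW]
    change ∫ θ in (-Real.pi)..Real.pi, Real.sin ((j + 1 : ℕ) * θ) ^ 2 * F θ ^ 2 ≤
      3 / 8 * (cosCoeff F (j + 1) ^ 2 / Real.pi) + _ at hS
    set Q := ∫ θ in (-Real.pi)..Real.pi, F θ ^ 2
    set B := cosCoeff F (j + 1) ^ 2 / Real.pi
    have h5 : c * (1 + 3 * t) ≤ m + 1 := by nlinarith
    have h6 := mul_le_mul_of_nonneg_left hS (mul_pos hc0 ht0).le
    have h7 := mul_le_mul_of_nonneg_right h5 hS0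
    have h8 : c * (1 + 3 / 8 * t) * B = m * B := by rw [hct]
    have h9 : (j : ℝ) + 2 = m + 1 := by rw [hm]; ring
    rw [h9] at hE
    nlinarith)
  refine lt_of_lt_of_le ?_ h
  have hI : ∫ θ in (-Real.pi)..Real.pi, w (Complex.exp (θ * Complex.I)) =
      Real.pi * (2 + t) := by
    simp only [hwθ]
    rw [intervalIntegral.integral_add (hi _ (by fun_prop)) (hi _ (by fun_prop)),
      intervalIntegral.integral_const_mul, integral_sin_sq_nat_mul (Nat.succ_ne_zero j),
      intervalIntegral.integral_const, smul_eq_mul]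
    ring
  have hlt : ((2 * j + 2 : ℕ) : ℝ) * Real.pi < c * (Real.pi * (2 + t)) := by
    have h1 : ((2 * j + 2 : ℕ) : ℝ) = 2 * (c * (1 + 3 / 8 * t)) := by
      rw [hct, hm]
      push_cast
      ring
    rw [h1]
    have := mul_pos (mul_pos hc0 ht0) hpi
    nlinarith
  rw [hI, ENNReal.ofReal_lt_ofReal_iff']
  exact ⟨hlt, lt_of_le_of_lt (by positivity) hlt⟩

theorem statement7 (p k : ℕ) (hp : 2 ≤ p) (hk : p ≤ k) :
    ENNReal.ofReal ((p : ℝ) * Real.pi) < SigmaP p k := by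
  rcases Nat.even_or_odd' p with ⟨j, rfl | rfl⟩
  · obtain ⟨i, rfl⟩ := Nat.exists_eq_add_of_le (show 1 ≤ j by omega)
    rw [show 2 * (1 + i) = 2 * i + 2 by ring] at hk ⊢
    exact ofReal_lt_sigmaP_even i k hk
  · exact ofReal_lt_sigmaP_odd j k hk

end
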